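/- For the extended bicopter system, the decoupling matrix equals β: for all χ ∈ ℝ⁸, L_{G₁}(L_F³H₁)(χ) = −(sin χ₃)/m, L_{G₂}(L_F³H₁)(χ) = −(cos χ₃)χ₇/(mJ), L_{G₁}(L_F³H₂)(χ) = (cos χ₃)/m, and L_{G₂}(L_F³H₂)(χ) = −(sin χ₃)χ₇/(mJ). -/

import Mathlib

/- Extended bicopter system. Paper indices χ₁,…,χ₈ correspond to Lean indices 0,…,7. -/

/-- Drift vector field of the dynamically extended bicopter. -/
noncomputable def Fdrift (m g : ℝ) (χ : Fin 8 → ℝ) : Fin 8 → ℝ :=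
  ![χ 3, χ 4, χ 5, -Real.sin (χ 2) * χ 6 / m, -g + Real.cos (χ 2) * χ 6 / m, 0, χ 7, 0]

/-- Input vector field G₁ = e₈. -/
noncomputable def G1 : (Fin 8 → ℝ) → Fin 8 → ℝ := fun _ => ![0, 0, 0, 0, 0, 0, 0, 1]

/-- Input vector field G₂ = (1/J)e₆. -/
noncomputable def G2 (J : ℝ) : (Fin 8 → ℝ) → Fin 8 → ℝ := fun _ => ![0, 0, 0, 0, 0, 1 / J, 0, 0]

/-- Lie derivative of a scalar function along a vector field: L_X h(χ) = Dh(χ)·X(χ). -/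
noncomputable def lieD (X : (Fin 8 → ℝ) → Fin 8 → ℝ) (h : (Fin 8 → ℝ) → ℝ)
    (χ : Fin 8 → ℝ) : ℝ :=
  fderiv ℝ h χ (X χ)

/-- Iterated Lie derivative along a vector field, with L_F^0 h = h. -/
noncomputable def lieIter (F : (Fin 8 → ℝ) → Fin 8 → ℝ) (h : (Fin 8 → ℝ) → ℝ) :
    ℕ → (Fin 8 → ℝ) → ℝ
  | 0 => h
  | n + 1 => lieD F (lieIter F h n)

/-- Outputs H₁(χ) = χ₁ and H₂(χ) = χ₂. -/
def Hout (i : Fin 2) (χ : Fin 8 → ℝ) : ℝ := χ (Fin.castLE (by norm_num) i)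

theorem lieD_eq_of_hasFDerivAt {X : (Fin 8 → ℝ) → Fin 8 → ℝ} {h : (Fin 8 → ℝ) → ℝ}
    {h' : (Fin 8 → ℝ) →L[ℝ] ℝ} {χ : Fin 8 → ℝ} (hh : HasFDerivAt h h' χ) :
    lieD X h χ = h' (X χ) := by
  rw [lieD, hh.fderiv]

theorem lieD_coord (X : (Fin 8 → ℝ) → Fin 8 → ℝ) (i : Fin 8) :
    lieD X (fun χ => χ i) = fun χ => X χ i := by
  funext χ
  exact lieD_eq_of_hasFDerivAt (hasFDerivAt_apply i χ)

/-- Two drift derivatives of the first output give the horizontal acceleration. -/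
theorem lieIter_Hout_zero_two (m g : ℝ) :
    lieIter (Fdrift m g) (Hout 0) 2 = fun χ => -Real.sin (χ 2) * χ 6 / m := by
  change lieD _ (lieD _ (fun χ => χ 0)) = _
  rw [lieD_coord]
  exact lieD_coord _ 3

/-- Two drift derivatives of the second output give the vertical acceleration. -/
theorem lieIter_Hout_one_two (m g : ℝ) :
    lieIter (Fdrift m g) (Hout 1) 2 = fun χ => -g + Real.cos (χ 2) * χ 6 / m := by
  change lieD _ (lieD _ (fun χ => χ 1)) = _
  rw [lieD_coord]
  exact lieD_coord _ 4

theorem lieD_neg_sin_mul_div (X : (Fin 8 → ℝ) → Fin 8 → ℝ) (m : ℝ) (χ : Fin 8 → ℝ) :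
    lieD X (fun χ => -Real.sin (χ 2) * χ 6 / m) χ =
      -(Real.cos (χ 2) * X χ 2 * χ 6 + Real.sin (χ 2) * X χ 6) / m := by
  have h2 := hasFDerivAt_apply (𝕜 := ℝ) (2 : Fin 8) χ
  have h6 := hasFDerivAt_apply (𝕜 := ℝ) (6 : Fin 8) χ
  have h := (h2.sin.neg.mul h6).mul_const m⁻¹
  refine (lieD_eq_of_hasFDerivAt h).trans ?_
  simp
  ring

theorem lieD_const_add_cos_mul_div (X : (Fin 8 → ℝ) → Fin 8 → ℝ) (m c : ℝ) (χ : Fin 8 → ℝ) :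
    lieD X (fun χ => c + Real.cos (χ 2) * χ 6 / m) χ =
      (-Real.sin (χ 2) * X χ 2 * χ 6 + Real.cos (χ 2) * X χ 6) / m := by
  have h2 := hasFDerivAt_apply (𝕜 := ℝ) (2 : Fin 8) χ
  have h6 := hasFDerivAt_apply (𝕜 := ℝ) (6 : Fin 8) χ
  have h := ((h2.cos.mul h6).mul_const m⁻¹).const_add c
  refine (lieD_eq_of_hasFDerivAt h).trans ?_
  simp
  ring

theorem lieIter_Hout_zero_three (m g : ℝ) :
    lieIter (Fdrift m g) (Hout 0) 3 =
      fun χ => -(Real.cos (χ 2) * χ 5 * χ 6 + Real.sin (χ 2) * χ 7) / m := by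
  funext χ
  rw [lieIter, lieIter_Hout_zero_two, lieD_neg_sin_mul_div]
  rfl

theorem lieIter_Hout_one_three (m g : ℝ) :
    lieIter (Fdrift m g) (Hout 1) 3 =
      fun χ => (-Real.sin (χ 2) * χ 5 * χ 6 + Real.cos (χ 2) * χ 7) / m := by
  funext χ
  rw [lieIter, lieIter_Hout_one_two, lieD_const_add_cos_mul_div]
  rfl

/-- Derivative of the horizontal jerk along a field that fixes the angle and the thrust. -/
theorem lieD_horizontal_jerk {X : (Fin 8 → ℝ) → Fin 8 → ℝ} (m : ℝ) {χ : Fin 8 → ℝ}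
    (hX2 : X χ 2 = 0) (hX6 : X χ 6 = 0) :
    lieD X (fun χ => -(Real.cos (χ 2) * χ 5 * χ 6 + Real.sin (χ 2) * χ 7) / m) χ =
      -(Real.cos (χ 2) * χ 6 * X χ 5 + Real.sin (χ 2) * X χ 7) / m := by
  have hc := fun i : Fin 8 => hasFDerivAt_apply (𝕜 := ℝ) i χ
  have h := ((((hc 2).cos.mul (hc 5)).mul (hc 6)).add ((hc 2).sin.mul (hc 7))).neg.mul_const m⁻¹
  refine (lieD_eq_of_hasFDerivAt h).trans ?_
  simp [hX2, hX6]
  ring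

/-- Derivative of the vertical jerk along a field that fixes the angle and the thrust. -/
theorem lieD_vertical_jerk {X : (Fin 8 → ℝ) → Fin 8 → ℝ} (m : ℝ) {χ : Fin 8 → ℝ}
    (hX2 : X χ 2 = 0) (hX6 : X χ 6 = 0) :
    lieD X (fun χ => (-Real.sin (χ 2) * χ 5 * χ 6 + Real.cos (χ 2) * χ 7) / m) χ =
      (-Real.sin (χ 2) * χ 6 * X χ 5 + Real.cos (χ 2) * X χ 7) / m := by
  have hc := fun i : Fin 8 => hasFDerivAt_apply (𝕜 := ℝ) i χ
  have h := ((((hc 2).sin.neg.mul (hc 5)).mul (hc 6)).add ((hc 2).cos.mul (hc 7))).mul_const m⁻¹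
  refine (lieD_eq_of_hasFDerivAt h).trans ?_
  simp [hX2, hX6]
  ring

/-- For the extended bicopter system, the decoupling matrix equals β:
L_{G₁}(L_F³H₁)(χ) = −(sin χ₃)/m, L_{G₂}(L_F³H₁)(χ) = −(cos χ₃)χ₇/(mJ),
L_{G₁}(L_F³H₂)(χ) = (cos χ₃)/m, and L_{G₂}(L_F³H₂)(χ) = −(sin χ₃)χ₇/(mJ). -/
theorem extended_bicopter_decoupling_matrix
    (m J g : ℝ) (hm : 0 < m) (hJ : 0 < J) (χ : Fin 8 → ℝ) :
    lieD G1 (lieIter (Fdrift m g) (Hout 0) 3) χ = -Real.sin (χ 2) / m ∧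
    lieD (G2 J) (lieIter (Fdrift m g) (Hout 0) 3) χ = -Real.cos (χ 2) * χ 6 / (m * J) ∧
    lieD G1 (lieIter (Fdrift m g) (Hout 1) 3) χ = Real.cos (χ 2) / m ∧
    lieD (G2 J) (lieIter (Fdrift m g) (Hout 1) 3) χ = -Real.sin (χ 2) * χ 6 / (m * J) := by
  rw [lieIter_Hout_zero_three, lieIter_Hout_one_three,
    lieD_horizontal_jerk m rfl rfl, lieD_horizontal_jerk m rfl rfl,
    lieD_vertical_jerk m rfl rfl, lieD_vertical_jerk m rfl rfl]
  refine ⟨?_, ?_, ?_, ?_⟩ <;> simp [G1, G2] <;> field_simp
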